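/- In S = R[X;σ,δ]^fl, the element X lies in the left nucleus N_l(S) (i.e. (X·p)·q = X·(p·q) for all p, q ∈ S) if and only if σ is a ring endomorphism of R and δ is both a left σ-derivation (δ(rs) = σ(r)δ(s) + δ(r)s for all r, s ∈ R) and a right σ-derivation (δ(rs) = δ(r)σ(s) + rδ(s) for all r, s ∈ R). -/

import Mathlib

/-- The π-functions `piFun σ δ m i = π_i^m`. -/
def piFun {R : Type*} [NonAssocRing R] (σ δ : R → R) : ℕ → ℕ → R → R
  | 0, 0, r => r
  | 0, _+1, _ => 0
  | m+1, 0, r => δ (piFun σ δ m 0 r)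
  | m+1, i+1, r => σ (piFun σ δ m i r) + δ (piFun σ δ m (i+1) r)

/-- `tau n r s = rs` if `n` is even and `sr` if `n` is odd. -/
def tau {R : Type*} [NonAssocRing R] (n : ℕ) (r s : R) : R :=
  if Even n then r * s else s * r

/-- The multiplication of the flipped generalized polynomial ring `R[X;σ,δ]^fl`:
the biadditive extension of `(rX^m)(sX^n) = Σ_i τ_n(r, π_i^m(s)) X^{i+n}`. Polynomials
are represented as finitely supported functions `ℕ →₀ R`. -/
noncomputable def flipMul {R : Type*} [NonAssocRing R] (σ δ : R → R) (p q : ℕ →₀ R) : ℕ →₀ R :=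
  p.sum fun m r => q.sum fun n s =>
    ∑ i ∈ Finset.range (m+1), Finsupp.single (i+n) (tau n r (piFun σ δ m i s))

section FlipMul

variable {R : Type*} [NonAssocRing R]

lemma tau_zero_left (n : ℕ) (s : R) : tau n 0 s = 0 := by simp [tau]

lemma tau_zero_right (n : ℕ) (r : R) : tau n r 0 = 0 := by simp [tau]

lemma tau_one_left (n : ℕ) (s : R) : tau n 1 s = s := by simp [tau]

lemma tau_add_left (n : ℕ) (r r' s : R) : tau n (r + r') s = tau n r s + tau n r' s := by
  unfold tau; split_ifs <;> simp [add_mul, mul_add]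

lemma tau_add_right (n : ℕ) (r s s' : R) : tau n r (s + s') = tau n r s + tau n r s' := by
  unfold tau; split_ifs <;> simp [add_mul, mul_add]

variable (σ δ : R →+ R)

lemma piFun_zero (m i : ℕ) : piFun σ δ m i 0 = 0 := by
  induction m generalizing i with
  | zero => cases i <;> simp [piFun]
  | succ m ih => cases i <;> simp [piFun, ih]

lemma piFun_add (m i : ℕ) (r s : R) :
    piFun σ δ m i (r + s) = piFun σ δ m i r + piFun σ δ m i s := by
  induction m generalizing i with
  | zero => cases i <;> simp [piFun]
  | succ m ih =>
    cases i with
    | zero => simp [piFun, ih]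
    | succ i => simp only [piFun, ih, map_add]; abel

lemma piFun_eq_zero_of_lt {m i : ℕ} (h : m < i) (r : R) : piFun σ δ m i r = 0 := by
  induction m generalizing i with
  | zero => cases i <;> simp_all [piFun]
  | succ m ih =>
    cases i with
    | zero => omega
    | succ i => simp [piFun, ih (show m < i by omega), ih (show m < i + 1 by omega)]

lemma flipMul_add_left (p p' q : ℕ →₀ R) :
    flipMul σ δ (p + p') q = flipMul σ δ p q + flipMul σ δ p' q := by
  refine Finsupp.sum_add_index' (fun m => ?_) (fun m r r' => ?_)
  · simp [tau_zero_left]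
  · simp [tau_add_left, Finset.sum_add_distrib, Finsupp.sum_add]

lemma flipMul_add_right (p q q' : ℕ →₀ R) :
    flipMul σ δ p (q + q') = flipMul σ δ p q + flipMul σ δ p q' := by
  unfold flipMul
  rw [← Finsupp.sum_add]
  refine Finsupp.sum_congr fun m _ => Finsupp.sum_add_index' (fun n => ?_) (fun n s s' => ?_)
  · simp [piFun_zero, tau_zero_right]
  · simp [piFun_add, tau_add_right, Finset.sum_add_distrib]

lemma flipMul_zero_left (q : ℕ →₀ R) : flipMul σ δ 0 q = 0 := by simp [flipMul]

lemma flipMul_zero_right (p : ℕ →₀ R) : flipMul σ δ p 0 = 0 := by simp [flipMul]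

lemma flipMul_sum_right {ι : Type*} (p : ℕ →₀ R) (t : Finset ι) (f : ι → ℕ →₀ R) :
    flipMul σ δ p (∑ i ∈ t, f i) = ∑ i ∈ t, flipMul σ δ p (f i) :=
  map_sum (AddMonoidHom.mk' (flipMul σ δ p) (flipMul_add_right σ δ p)) f t

lemma flipMul_single_single (m n : ℕ) (r s : R) :
    flipMul σ δ (Finsupp.single m r) (Finsupp.single n s) =
      ∑ i ∈ Finset.range (m + 1), Finsupp.single (i + n) (tau n r (piFun σ δ m i s)) := by
  unfold flipMul
  rw [Finsupp.sum_single_index, Finsupp.sum_single_index]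
  · simp [piFun_zero, tau_zero_right]
  · simp [tau_zero_left]

lemma flipMul_X_single (n : ℕ) (s : R) :
    flipMul σ δ (Finsupp.single 1 1) (Finsupp.single n s) =
      Finsupp.single n (δ s) + Finsupp.single (n + 1) (σ s) := by
  simp [flipMul_single_single, Finset.sum_range_succ, tau_one_left, piFun, add_comm 1 n]

lemma flipMul_X_assoc_single
    (hσ : ∀ n r s, σ (tau n r s) = tau n (σ r) (σ s))
    (hδ : ∀ n r s, δ (tau n r s) = tau n (δ r) s + tau n (σ r) (δ s)) (m n : ℕ) (r s : R) :
    flipMul σ δ (flipMul σ δ (Finsupp.single 1 1) (Finsupp.single m r)) (Finsupp.single n s) =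
      flipMul σ δ (Finsupp.single 1 1)
        (flipMul σ δ (Finsupp.single m r) (Finsupp.single n s)) := by
  have shift : ∑ i ∈ Finset.range (m + 1),
        Finsupp.single (i + 1 + n) (tau n (σ r) (δ (piFun σ δ m (i + 1) s))) +
        Finsupp.single (0 + n) (tau n (σ r) (δ (piFun σ δ m 0 s))) =
      ∑ i ∈ Finset.range (m + 1),
        Finsupp.single (i + n) (tau n (σ r) (δ (piFun σ δ m i s))) := by
    rw [← Finset.sum_range_succ' fun i =>
      Finsupp.single (i + n) (tau n (σ r) (δ (piFun σ δ m i s))), Finset.sum_range_succ]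
    simp [piFun_eq_zero_of_lt, tau_zero_right]
  rw [flipMul_X_single, flipMul_add_left, flipMul_single_single σ δ m n r s]
  simp only [flipMul_sum_right, flipMul_X_single]
  simp only [flipMul_single_single, hσ, hδ, Finsupp.single_add, Finset.sum_add_distrib]
  rw [Finset.sum_range_succ' _ (m + 1)]
  simp only [piFun, tau_add_right, Finsupp.single_add, Finset.sum_add_distrib]
  rw [← shift]
  simp only [add_right_comm _ n 1]
  abel

end FlipMul

/-- in `S = R[X;σ,δ]^fl`, `X` lies in the left nucleus `N_l(S)` if and only if
`σ` is a ring endomorphism and `δ` is both a left and a right `σ`-derivation. -/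
theorem X_mem_leftNucleus_iff {R : Type*} [NonAssocRing R]
    (σ δ : R →+ R) (hσ : σ 1 = 1) (hδ : δ 1 = 0) :
    (∀ p q : ℕ →₀ R,
      flipMul (σ : R → R) (δ : R → R)
          (flipMul (σ : R → R) (δ : R → R) (Finsupp.single 1 1) p) q
        = flipMul (σ : R → R) (δ : R → R) (Finsupp.single 1 1)
            (flipMul (σ : R → R) (δ : R → R) p q)) ↔
    ((∀ r s : R, σ (r * s) = σ r * σ s) ∧
     (∀ r s : R, δ (r * s) = σ r * δ s + δ r * s) ∧
     (∀ r s : R, δ (r * s) = δ r * σ s + r * δ s)) := by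
  constructor
  · intro h
    have even_case (r s : R) := h (Finsupp.single 0 r) (Finsupp.single 0 s)
    have odd_case (r s : R) := h (Finsupp.single 0 r) (Finsupp.single 1 s)
    simp only [flipMul_X_single, flipMul_add_left] at even_case odd_case
    simp only [flipMul_single_single, flipMul_sum_right] at even_case odd_case
    refine ⟨fun r s => ?_, fun r s => ?_, fun r s => ?_⟩
    · simpa [Finset.sum_range_succ, piFun, tau] using
        (DFunLike.congr_fun (even_case r s) 1).symm
    · simpa [Finset.sum_range_succ, piFun, tau, add_comm] using
        (DFunLike.congr_fun (even_case r s) 0).symm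
    · simpa [Finset.sum_range_succ, piFun, tau, add_comm] using
        (DFunLike.congr_fun (odd_case s r) 1).symm
  · rintro ⟨hmul, hleft, hright⟩ p q
    have map_tau (n : ℕ) (r s : R) : σ (tau n r s) = tau n (σ r) (σ s) := by
      unfold tau; split_ifs <;> simp [hmul]
    have deriv_tau (n : ℕ) (r s : R) :
        δ (tau n r s) = tau n (δ r) s + tau n (σ r) (δ s) := by
      unfold tau
      split_ifs
      · rw [hleft, add_comm]
      · rw [hright, add_comm]
    induction p using Finsupp.induction_linear with
    | zero => simp [flipMul_zero_left, flipMul_zero_right]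
    | add p p' hp hp' => simp only [flipMul_add_left, flipMul_add_right, hp, hp']
    | single m r =>
      induction q using Finsupp.induction_linear with
      | zero => simp [flipMul_zero_right]
      | add q q' hq hq' => simp only [flipMul_add_right, hq, hq']
      | single n s => exact flipMul_X_assoc_single σ δ map_tau deriv_tau m n r s
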